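/- arXiv:2205.11831 — 2 statements merged into one kernel-verified Lean document; each statement's English description precedes it below -/
import Mathlib

section
/- Assume in addition that Σ is a compact operator and is injective, and that V* ∈ H satisfies the unregularized fixed-point equation b + (γΣ₁ − Σ)V* = 0. For each λ > 0 let V*_λ := (Σ + λI − γΣ₁)^{-1} b. Then ‖Σ^{1/2}(V*_λ − V*)‖ tends to 0 as λ → 0⁺. -/
open Filter
open scoped InnerProductSpace Topology

/-- Energy estimate: a perturbation `e` with `(S² + l - γ S T S) e = -l v` satisfies
`(1 - γ) ‖S e‖² ≤ l ‖v‖²`. -/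
theorem one_sub_mul_sq_norm_le
    {H : Type*} [NormedAddCommGroup H] [InnerProductSpace ℝ H] [CompleteSpace H]
    (S T : H →L[ℝ] H) (hS : IsSelfAdjoint S) (hT : ‖T‖ ≤ 1)
    {γ l : ℝ} (hγ : 0 ≤ γ) (hl : 0 ≤ l) (e v : H)
    (h : S (S e) + l • e - γ • S (T (S e)) = -(l • v)) :
    (1 - γ) * ‖S e‖ ^ 2 ≤ l * ‖v‖ ^ 2 := by
  have hsymm : ∀ x y : H, ⟪S x, y⟫_ℝ = ⟪x, S y⟫_ℝ := hS.isSymmetric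
  have henergy : ‖S e‖ ^ 2 + l * ‖e‖ ^ 2 - γ * ⟪S e, T (S e)⟫_ℝ = -(l * ⟪e, v⟫_ℝ) := by
    have := congrArg (fun x => ⟪e, x⟫_ℝ) h
    simpa only [inner_sub_right, inner_add_right, inner_neg_right, real_inner_smul_right,
      ← hsymm e, real_inner_self_eq_norm_sq] using this
  have hTS : ⟪S e, T (S e)⟫_ℝ ≤ ‖S e‖ ^ 2 :=
    calc ⟪S e, T (S e)⟫_ℝ ≤ ‖S e‖ * ‖T (S e)‖ := real_inner_le_norm _ _
      _ ≤ ‖S e‖ * ‖S e‖ := by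
        gcongr
        simpa using T.le_of_opNorm_le hT (S e)
      _ = ‖S e‖ ^ 2 := (sq _).symm
  have hev : -⟪e, v⟫_ℝ ≤ ‖e‖ * ‖v‖ := (abs_le.mp (abs_real_inner_le_norm e v)) |>.1 |> neg_le.mp
  have hquad : -⟪e, v⟫_ℝ - ‖e‖ ^ 2 ≤ ‖v‖ ^ 2 := by
    nlinarith [sq_nonneg (‖e‖ - ‖v‖), sq_nonneg ‖e‖, sq_nonneg ‖v‖]
  nlinarith [mul_le_mul_of_nonneg_left hTS hγ, mul_le_mul_of_nonneg_left hquad hl]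

/-- Cor. for Mercer kernels: if moreover `Σ` is compact and injective and `V*`
solves the unregularized fixed-point equation `b + (γΣ₁ - Σ)V* = 0`, then, with
`V*_λ = (Σ + λI - γΣ₁)⁻¹ b` (characterized by `(Σ + λI - γΣ₁) V*_λ = b` for each `λ > 0`),
`‖Σ^{1/2}(V*_λ - V*)‖ → 0` as `λ → 0⁺`. -/
theorem regularized_fixed_point_tendsto
    {H : Type*} [NormedAddCommGroup H] [InnerProductSpace ℝ H] [CompleteSpace H]
    (Sig S T1 Sig1 : H →L[ℝ] H)
    (hSigSA : IsSelfAdjoint Sig) (hSigPos : ∀ f : H, 0 ≤ ⟪f, Sig f⟫_ℝ)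
    (hSsa : IsSelfAdjoint S) (hSpos : ∀ f : H, 0 ≤ ⟪f, S f⟫_ℝ) (hSsq : S * S = Sig)
    (hT1 : ‖T1‖ ≤ 1) (hSig1 : Sig1 = S * T1 * S)
    (γ : ℝ) (hγ0 : 0 ≤ γ) (hγ1 : γ < 1) (b : H)
    (hcompact : IsCompactOperator (⇑Sig)) (hinj : Function.Injective (⇑Sig))
    (Vstar : H) (hVstar : b + (γ • Sig1 - Sig) Vstar = 0)
    (Vlam : ℝ → H) (hVlam : ∀ l : ℝ, 0 < l → (Sig + l • 1 - γ • Sig1) (Vlam l) = b) :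
    Tendsto (fun l : ℝ => ‖S (Vlam l - Vstar)‖) (𝓝[>] 0) (𝓝 0) := by
  have hbound : ∀ l : ℝ, 0 < l → ‖S (Vlam l - Vstar)‖ ≤ √(l * ‖Vstar‖ ^ 2 / (1 - γ)) := by
    intro l hl
    apply Real.le_sqrt_of_sq_le
    rw [le_div_iff₀ (sub_pos.mpr hγ1), mul_comm]
    refine one_sub_mul_sq_norm_le S T1 hSsa hT1 hγ0 hl.le _ _ ?_
    have h := hVlam l hl
    subst hSig1 hSsq
    simp only [sub_apply, add_apply, smul_apply, mul_apply_eq_comp, one_apply_eq_self] at h hVstar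
    rw [← h] at hVstar
    simp only [map_sub, smul_sub]
    rw [← sub_eq_zero, ← hVstar]
    abel
  have hlim : Tendsto (fun l : ℝ => √(l * ‖Vstar‖ ^ 2 / (1 - γ))) (𝓝[>] 0) (𝓝 0) := by
    have hcont : Continuous fun l : ℝ => √(l * ‖Vstar‖ ^ 2 / (1 - γ)) := by fun_prop
    simpa using (hcont.tendsto 0).mono_left nhdsWithin_le_nhds
  refine squeeze_zero' (Eventually.of_forall fun _ => norm_nonneg _) ?_ hlim
  filter_upwards [self_mem_nhdsWithin] with l hl using hbound l hl
end

section
/- Let λ > 0 and V*_λ := (Σ + λI − γΣ₁)^{-1} b. For every V ∈ H and every ρ ≥ 0, defining the H-valued random vector Z := V + ρ·[(R + γ⟨V, X′⟩ − ⟨V, X⟩)·X − λ·V], one has E[‖Z − V*_λ‖²] ≤ (1 − 2ρλ + 2ρ²λ²)·‖V − V*_λ‖² − (2ρ(1 − γ) − 8ρ²(1 + γ²)M)·‖Σ^{1/2}(V − V*_λ)‖² + 4ρ²σ². -/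
open MeasureTheory ProbabilityTheory
open scoped InnerProductSpace

theorem integrable_and_integral_add_const_mul {α : Type*} [MeasurableSpace α] {μ : Measure α}
    {f g : α → ℝ} {a b : ℝ} (hf : Integrable f μ ∧ ∫ x, f x ∂μ = a)
    (hg : Integrable g μ ∧ ∫ x, g x ∂μ = b) (c : ℝ) :
    Integrable (fun x => f x + c * g x) μ ∧ ∫ x, f x + c * g x ∂μ = a + c * b := by
  refine ⟨hf.1.add (hg.1.const_mul c), ?_⟩
  rw [integral_add hf.1 (hg.1.const_mul c), integral_const_mul, hf.2, hg.2]

theorem norm_add_sq_le_two_mul {E : Type*} [NormedAddCommGroup E] [InnerProductSpace ℝ E]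
    (x y : E) : ‖x + y‖ ^ 2 ≤ 2 * ‖x‖ ^ 2 + 2 * ‖y‖ ^ 2 := by
  nlinarith [parallelogram_law_with_norm ℝ x y, mul_self_nonneg ‖x - y‖]

/-- A factored operator `S T S` with `S` self-adjoint and `‖T‖ ≤ 1` is dominated by `S²`. -/
theorem inner_factored_le_norm_sq {H : Type*} [NormedAddCommGroup H] [InnerProductSpace ℝ H]
    [CompleteSpace H] {S T : H →L[ℝ] H} (hS : IsSelfAdjoint S) (hT : ‖T‖ ≤ 1) (f : H) :
    ⟪f, (S * T * S) f⟫_ℝ ≤ ‖S f‖ ^ 2 := by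
  have h : ⟪f, (S * T * S) f⟫_ℝ = ⟪S f, T (S f)⟫_ℝ := by
    simpa using (hS.isSymmetric f (T (S f))).symm
  rw [h]
  have h1 := real_inner_le_norm (S f) (T (S f))
  have h2 := T.le_of_opNorm_le hT (S f)
  nlinarith [norm_nonneg (S f)]

/-- The regularization bias of the regularized solution `U` relative to `V`, measured
in the seminorm `‖S ·‖`. -/
theorem one_sub_sq_mul_norm_sq_bias_le {H : Type*} [NormedAddCommGroup H] [InnerProductSpace ℝ H]
    [CompleteSpace H] {S T : H →L[ℝ] H} (hS : IsSelfAdjoint S) (hT : ‖T‖ ≤ 1)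
    {γ lam : ℝ} (hγ : 0 ≤ γ) (hlam : 0 < lam) {U V : H}
    (h : (S * S + lam • 1 - γ • (S * T * S)) U = (S * S - γ • (S * T * S)) V) :
    (1 - γ ^ 2) * ‖S (U - V)‖ ^ 2 ≤ ‖S V‖ ^ 2 := by
  set e := S (U - V) with he
  set w := γ • T e - e with hw
  have hlamU : lam • U = S w := by
    simp only [sub_apply, add_apply,
      smul_apply, mul_apply_eq_comp,
      one_apply_eq_self] at h
    simp only [hw, he, map_sub, map_smul, smul_sub]
    rw [← sub_eq_zero] at h ⊢
    rw [← h]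
    abel
  have hpos : 0 ≤ ⟪S U, w⟫_ℝ := by
    have h1 : ⟪S U, w⟫_ℝ = ⟪U, S w⟫_ℝ := hS.isSymmetric U w
    rw [h1, ← hlamU, real_inner_smul_right, real_inner_self_eq_norm_sq]
    positivity
  have hSU : S U = S V + e := by simp [he]
  rw [hSU, inner_add_left] at hpos
  have hew : e + w = γ • T e := by simp [hw]
  have h2 : ‖e + w‖ ≤ γ * ‖e‖ := by
    rw [hew, norm_smul, Real.norm_of_nonneg hγ]
    gcongr
    simpa using T.le_of_opNorm_le hT e
  have h3 : ‖e + w‖ ^ 2 ≤ (γ * ‖e‖) ^ 2 := by gcongr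
  rw [norm_add_sq_real] at h3
  have h4 := norm_sub_sq_real (S V) w
  nlinarith [sq_nonneg ‖S V - w‖]

/-- Pointwise bound on the squared norm of a regularized temporal-difference increment at `U + W`
in terms of `W` and the increment at `U`. -/
theorem norm_sq_td_increment_le {H : Type*} [NormedAddCommGroup H] [InnerProductSpace ℝ H]
    {x x' U W : H} {r γ lam M : ℝ} (hx : ‖x‖ ^ 2 ≤ M) :
    ‖(r + γ * ⟪U + W, x'⟫_ℝ - ⟪U + W, x⟫_ℝ) • x - lam • (U + W)‖ ^ 2 ≤
      2 * lam ^ 2 * ‖W‖ ^ 2 + 8 * M * (γ ^ 2 * ⟪W, x'⟫_ℝ ^ 2 + ⟪W, x⟫_ℝ ^ 2)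
        + 4 * (M * (2 * r ^ 2 + 4 * γ ^ 2 * ⟪U, x'⟫_ℝ ^ 2 + 4 * ⟪U, x⟫_ℝ ^ 2)
          - 2 * lam * ((r + γ * ⟪U, x'⟫_ℝ - ⟪U, x⟫_ℝ) * ⟪U, x⟫_ℝ) + lam ^ 2 * ‖U‖ ^ 2) := by
  set d := r + γ * ⟪U, x'⟫_ℝ - ⟪U, x⟫_ℝ with hd
  set c := γ * ⟪W, x'⟫_ℝ - ⟪W, x⟫_ℝ with hc
  have hsplit : (r + γ * ⟪U + W, x'⟫_ℝ - ⟪U + W, x⟫_ℝ) • x - lam • (U + W)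
      = (-lam) • W + (c • x + (d • x - lam • U)) := by
    have : r + γ * ⟪U + W, x'⟫_ℝ - ⟪U + W, x⟫_ℝ = c + d := by
      simp only [inner_add_left, hc, hd]; ring
    rw [this]; module
  rw [hsplit]
  have h1 := norm_add_sq_le_two_mul ((-lam) • W) (c • x + (d • x - lam • U))
  have h2 := norm_add_sq_le_two_mul (c • x) (d • x - lam • U)
  have h3 := norm_sub_sq_real (d • x) (lam • U)
  rw [real_inner_smul_left, real_inner_smul_right, real_inner_comm] at h3
  simp only [norm_smul, mul_pow, Real.norm_eq_abs, sq_abs, neg_sq] at h1 h2 h3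
  have hM : 0 ≤ M := (sq_nonneg _).trans hx
  have hcx : c ^ 2 * ‖x‖ ^ 2 ≤ (2 * (γ ^ 2 * ⟪W, x'⟫_ℝ ^ 2 + ⟪W, x⟫_ℝ ^ 2)) * M := by
    gcongr
    rw [hc]; nlinarith [sq_nonneg (γ * ⟪W, x'⟫_ℝ + ⟪W, x⟫_ℝ)]
  have hdx : d ^ 2 * ‖x‖ ^ 2 ≤
      (2 * r ^ 2 + 4 * γ ^ 2 * ⟪U, x'⟫_ℝ ^ 2 + 4 * ⟪U, x⟫_ℝ ^ 2) * M := by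
    gcongr
    rw [hd]
    nlinarith [sq_nonneg (γ * ⟪U, x'⟫_ℝ + ⟪U, x⟫_ℝ),
      sq_nonneg (r - (γ * ⟪U, x'⟫_ℝ - ⟪U, x⟫_ℝ))]
  linarith

/-- one-step descent inequality, i.i.d. setting: with `Σ`, `Σ₁` the covariance
operators of `(X, X')`, `S = Σ^{1/2}`, `Σ₁ = S Σ̃₁ S` with `‖Σ̃₁‖ ≤ 1`, `b = E[R·X]`,
`V*` the solution of `b + (γΣ₁ - Σ)V* = 0`,
`σ² = 10 M E[R²] + (8(1+γ²)/(1-γ)² + 16(1+γ²)) M ‖Σ^{1/2}V*‖²`, `λ > 0`,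
`V*_λ = (Σ + λI - γΣ₁)⁻¹ b`, `V ∈ H`, `ρ ≥ 0`, and
`Z = V + ρ[(R + γ⟪V,X'⟫ - ⟪V,X⟫)X - λV]`, one has
`E[‖Z - V*_λ‖²] ≤ (1 - 2ρλ + 2ρ²λ²)‖V - V*_λ‖² - (2ρ(1-γ) - 8ρ²(1+γ²)M)‖Σ^{1/2}(V-V*_λ)‖²
  + 4ρ²σ²`. -/
theorem td_stochastic_one_step_descent
    {H : Type*} [NormedAddCommGroup H] [InnerProductSpace ℝ H] [CompleteSpace H]
    [MeasurableSpace H] [BorelSpace H]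
    {Ω : Type*} [MeasurableSpace Ω] (P : Measure Ω) [IsProbabilityMeasure P]
    (M γ : ℝ) (hM : 0 < M) (hγ0 : 0 ≤ γ) (hγ1 : γ < 1)
    (X X' : Ω → H) (R : Ω → ℝ)
    (hXmeas : StronglyMeasurable X) (hX'meas : StronglyMeasurable X') (hRmeas : Measurable R)
    (hid : IdentDistrib X X' P P)
    (hXb : ∀ᵐ ω ∂P, ‖X ω‖ ≤ Real.sqrt M) (hX'b : ∀ᵐ ω ∂P, ‖X' ω‖ ≤ Real.sqrt M)
    (hR2 : Integrable (fun ω => (R ω) ^ 2) P)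
    (Sig Sig1 : H →L[ℝ] H)
    (hSig : ∀ f g : H, ⟪f, Sig g⟫_ℝ = ∫ ω, ⟪f, X ω⟫_ℝ * ⟪g, X ω⟫_ℝ ∂P)
    (hSig1 : ∀ f g : H, ⟪f, Sig1 g⟫_ℝ = ∫ ω, ⟪f, X ω⟫_ℝ * ⟪g, X' ω⟫_ℝ ∂P)
    (S : H →L[ℝ] H) (hSsa : IsSelfAdjoint S) (hSpos : ∀ f : H, 0 ≤ ⟪f, S f⟫_ℝ)
    (hSsq : S * S = Sig)
    (b : H) (hb : b = ∫ ω, R ω • X ω ∂P)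
    (T1 : H →L[ℝ] H) (hT1 : ‖T1‖ ≤ 1) (hfac : Sig1 = S * T1 * S)
    (Vstar : H) (hVstar : b + (γ • Sig1 - Sig) Vstar = 0)
    (σ2 : ℝ)
    (hσ2 : σ2 = 10 * M * (∫ ω, (R ω) ^ 2 ∂P) +
      (8 * (1 + γ ^ 2) / (1 - γ) ^ 2 + 16 * (1 + γ ^ 2)) * M * ‖S Vstar‖ ^ 2)
    (lam : ℝ) (hlam : 0 < lam)
    (Vlam : H) (hVlam : (Sig + lam • 1 - γ • Sig1) Vlam = b)
    (V : H) (ρ : ℝ) (hρ : 0 ≤ ρ) :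
    ∫ ω, ‖(V + ρ • ((R ω + γ * ⟪V, X' ω⟫_ℝ - ⟪V, X ω⟫_ℝ) • X ω - lam • V)) - Vlam‖ ^ 2 ∂P ≤
      (1 - 2 * ρ * lam + 2 * ρ ^ 2 * lam ^ 2) * ‖V - Vlam‖ ^ 2
        - (2 * ρ * (1 - γ) - 8 * ρ ^ 2 * (1 + γ ^ 2) * M) * ‖S (V - Vlam)‖ ^ 2
        + 4 * ρ ^ 2 * σ2 := by
  have hXb2 : ∀ᵐ ω ∂P, ‖X ω‖ ^ 2 ≤ M := by
    filter_upwards [hXb] with ω h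
    exact (Real.le_sqrt (norm_nonneg _) hM.le).1 h
  have hX2 : MemLp X 2 P := MemLp.of_bound hXmeas.aestronglyMeasurable _ hXb
  have hX'2 : MemLp X' 2 P := MemLp.of_bound hX'meas.aestronglyMeasurable _ hX'b
  have hRL : MemLp R 2 P := (memLp_two_iff_integrable_sq hRmeas.aestronglyMeasurable).2 hR2
  have hfX (f : H) : MemLp (fun ω => ⟪f, X ω⟫_ℝ) 2 P := hX2.const_inner f
  have hfX' (f : H) : MemLp (fun ω => ⟪f, X' ω⟫_ℝ) 2 P := hX'2.const_inner f
  have hRX (f : H) : Integrable (fun ω => R ω * ⟪f, X ω⟫_ℝ) P := hRL.integrable_mul (hfX f)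
  have hXX (f g : H) : Integrable (fun ω => ⟪f, X ω⟫_ℝ * ⟪g, X ω⟫_ℝ) P :=
    (hfX f).integrable_mul (hfX g)
  have hXX' (f g : H) : Integrable (fun ω => ⟪f, X ω⟫_ℝ * ⟪g, X' ω⟫_ℝ) P :=
    (hfX f).integrable_mul (hfX' g)
  have hXsq (f : H) : Integrable (fun ω => ⟪f, X ω⟫_ℝ ^ 2) P := (hfX f).integrable_sq
  have hX'sq (f : H) : Integrable (fun ω => ⟪f, X' ω⟫_ℝ ^ 2) P := (hfX' f).integrable_sq
  have hSS (f : H) : ⟪f, Sig f⟫_ℝ = ‖S f‖ ^ 2 := by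
    rw [← hSsq, ← real_inner_self_eq_norm_sq]
    exact (hSsa.isSymmetric f (S f)).symm
  have hEX (f : H) : ∫ ω, ⟪f, X ω⟫_ℝ ^ 2 ∂P = ‖S f‖ ^ 2 := by
    rw [← hSS, hSig]
    simp only [sq]
  have hEX' (f : H) : ∫ ω, ⟪f, X' ω⟫_ℝ ^ 2 ∂P = ‖S f‖ ^ 2 := by
    have hm : Measurable (fun x : H => ⟪f, x⟫_ℝ ^ 2) :=
      Continuous.measurable (by fun_prop)
    rw [← hEX]
    exact (hid.comp hm).integral_eq.symm
  have hERX (f : H) : ∫ ω, R ω * ⟪f, X ω⟫_ℝ ∂P = ⟪f, b⟫_ℝ := by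
    have hi : Integrable (fun ω => R ω • X ω) P :=
      memLp_one_iff_integrable.1 (hX2.smul hRL)
    rw [hb, ← integral_inner hi f]
    simp only [real_inner_smul_right]
  have htd (f g : H) :
      Integrable (fun ω => (R ω + γ * ⟪g, X' ω⟫_ℝ - ⟪g, X ω⟫_ℝ) * ⟪f, X ω⟫_ℝ) P ∧
      ∫ ω, (R ω + γ * ⟪g, X' ω⟫_ℝ - ⟪g, X ω⟫_ℝ) * ⟪f, X ω⟫_ℝ ∂P
        = ⟪f, b⟫_ℝ + γ * ⟪f, Sig1 g⟫_ℝ - ⟪f, Sig g⟫_ℝ := by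
    have heq : (fun ω => (R ω + γ * ⟪g, X' ω⟫_ℝ - ⟪g, X ω⟫_ℝ) * ⟪f, X ω⟫_ℝ)
        = fun ω => R ω * ⟪f, X ω⟫_ℝ + γ * (⟪f, X ω⟫_ℝ * ⟪g, X' ω⟫_ℝ)
          + -1 * (⟪f, X ω⟫_ℝ * ⟪g, X ω⟫_ℝ) := by
      ext ω; ring
    rw [heq, sub_eq_add_neg, neg_eq_neg_one_mul ⟪f, Sig g⟫_ℝ]
    exact integrable_and_integral_add_const_mul (integrable_and_integral_add_const_mul
      ⟨hRX f, hERX f⟩ ⟨hXX' f g, (hSig1 f g).symm⟩ γ) ⟨hXX f g, (hSig f g).symm⟩ (-1)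
  obtain ⟨W, rfl⟩ : ∃ W, V = Vlam + W := ⟨V - Vlam, by abel⟩
  rw [add_sub_cancel_left]
  have hbU (f : H) :
      ⟪f, b⟫_ℝ = ⟪f, Sig Vlam⟫_ℝ + lam * ⟪f, Vlam⟫_ℝ - γ * ⟪f, Sig1 Vlam⟫_ℝ := by
    rw [← hVlam]
    simp [inner_sub_right, inner_add_right, real_inner_smul_right]
  have hbias : (1 - γ ^ 2) * ‖S (Vlam - Vstar)‖ ^ 2 ≤ ‖S Vstar‖ ^ 2 := by
    refine one_sub_sq_mul_norm_sq_bias_le (lam := lam) hSsa hT1 hγ0 hlam ?_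
    rw [← hfac, hSsq, hVlam, eq_neg_of_add_eq_zero_left hVstar, ← neg_apply,
      neg_sub]
  have hSU : ‖S Vlam‖ ^ 2 ≤ (2 / (1 - γ) ^ 2 + 2) * ‖S Vstar‖ ^ 2 := by
    have h1 := norm_add_sq_le_two_mul (S (Vlam - Vstar)) (S Vstar)
    rw [← map_add, sub_add_cancel] at h1
    have h2 : ‖S (Vlam - Vstar)‖ ^ 2 ≤ ‖S Vstar‖ ^ 2 / (1 - γ) ^ 2 := by
      rw [le_div_iff₀ (by have := sub_pos.2 hγ1; positivity)]
      have h3 : (1 - γ) ^ 2 ≤ 1 - γ ^ 2 := by nlinarith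
      nlinarith [sq_nonneg ‖S (Vlam - Vstar)‖]
    calc _ ≤ 2 * (‖S Vstar‖ ^ 2 / (1 - γ) ^ 2) + 2 * ‖S Vstar‖ ^ 2 := by linarith
      _ = _ := by ring
  have hdrift : ⟪W, b⟫_ℝ + γ * ⟪W, Sig1 (Vlam + W)⟫_ℝ - ⟪W, Sig (Vlam + W)⟫_ℝ
      - lam * ⟪W, Vlam + W⟫_ℝ ≤ -(1 - γ) * ‖S W‖ ^ 2 - lam * ‖W‖ ^ 2 := by
    have h1 : ⟪W, Sig1 W⟫_ℝ ≤ ‖S W‖ ^ 2 := hfac ▸ inner_factored_le_norm_sq hSsa hT1 W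
    rw [hbU]
    simp only [map_add, inner_add_right, hSS, real_inner_self_eq_norm_sq]
    nlinarith
  have hnoise : 2 * M * (∫ ω, R ω ^ 2 ∂P) + 4 * (1 + γ ^ 2) * M * ‖S Vlam‖ ^ 2 ≤ σ2 := by
    have h0 : 0 ≤ ∫ ω, R ω ^ 2 ∂P := integral_nonneg fun ω => sq_nonneg _
    have h1 : 4 * (1 + γ ^ 2) * M * ‖S Vlam‖ ^ 2
        ≤ 4 * (1 + γ ^ 2) * M * ((2 / (1 - γ) ^ 2 + 2) * ‖S Vstar‖ ^ 2) := by gcongr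
    have h2 : 4 * (1 + γ ^ 2) * M * ((2 / (1 - γ) ^ 2 + 2) * ‖S Vstar‖ ^ 2)
        = (8 * (1 + γ ^ 2) / (1 - γ) ^ 2 + 8 * (1 + γ ^ 2)) * M * ‖S Vstar‖ ^ 2 := by ring
    have h3 : 0 ≤ 8 * (1 + γ ^ 2) * M * ‖S Vstar‖ ^ 2 := by positivity
    have h4 : 0 ≤ M * ∫ ω, R ω ^ 2 ∂P := by positivity
    rw [hσ2]
    linarith
  have hG := integrable_and_integral_add_const_mul (integrable_and_integral_add_const_mul
    (integrable_and_integral_add_const_mul (integrable_and_integral_add_const_mul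
    (integrable_and_integral_add_const_mul (integrable_and_integral_add_const_mul
    (integrable_and_integral_add_const_mul
      (⟨integrable_const _, by simp⟩ : Integrable (fun _ => ‖W‖ ^ 2 - 2 * ρ * lam * ⟪W, Vlam + W⟫_ℝ
        + ρ ^ 2 * (2 * lam ^ 2 * ‖W‖ ^ 2 + 4 * lam ^ 2 * ‖Vlam‖ ^ 2)) P ∧
        ∫ _, _ ∂P = ‖W‖ ^ 2 - 2 * ρ * lam * ⟪W, Vlam + W⟫_ℝ
        + ρ ^ 2 * (2 * lam ^ 2 * ‖W‖ ^ 2 + 4 * lam ^ 2 * ‖Vlam‖ ^ 2))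
      (htd W (Vlam + W)) (2 * ρ))
      ⟨hX'sq W, hEX' W⟩ (8 * ρ ^ 2 * M * γ ^ 2))
      ⟨hXsq W, hEX W⟩ (8 * ρ ^ 2 * M))
      ⟨hR2, rfl⟩ (8 * ρ ^ 2 * M))
      ⟨hX'sq Vlam, hEX' Vlam⟩ (16 * ρ ^ 2 * M * γ ^ 2))
      ⟨hXsq Vlam, hEX Vlam⟩ (16 * ρ ^ 2 * M))
      (htd Vlam Vlam) (-(8 * ρ ^ 2 * lam))
  refine (integral_mono_of_nonneg (ae_of_all _ fun ω => sq_nonneg _) hG.1 ?_).trans ?_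
  · filter_upwards [hXb2] with ω hω
    have h1 := mul_le_mul_of_nonneg_left (norm_sq_td_increment_le (x' := X' ω) (U := Vlam) (W := W)
      (r := R ω) (γ := γ) (lam := lam) hω) (sq_nonneg ρ)
    set A := (R ω + γ * ⟪Vlam + W, X' ω⟫_ℝ - ⟪Vlam + W, X ω⟫_ℝ) • X ω - lam • (Vlam + W) with hA
    have h2 : Vlam + W + ρ • A - Vlam = W + ρ • A := by abel
    have h3 : ⟪W, A⟫_ℝ = (R ω + γ * ⟪Vlam + W, X' ω⟫_ℝ - ⟪Vlam + W, X ω⟫_ℝ) * ⟪W, X ω⟫_ℝ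
        - lam * ⟪W, Vlam + W⟫_ℝ := by
      rw [hA, inner_sub_right, real_inner_smul_right, real_inner_smul_right]
    rw [h2, norm_add_sq_real, real_inner_smul_right, h3, norm_smul, mul_pow, Real.norm_eq_abs,
      sq_abs]
    linarith
  · rw [hG.2, hbU Vlam, hSS, real_inner_self_eq_norm_sq]
    have h1 := mul_le_mul_of_nonneg_left hdrift (by positivity : 0 ≤ 2 * ρ)
    have h2 := mul_le_mul_of_nonneg_left hnoise (by positivity : 0 ≤ 4 * ρ ^ 2)
    have h3 : 0 ≤ ρ ^ 2 * lam ^ 2 * ‖Vlam‖ ^ 2 := by positivity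
    linarith
end
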